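/- Let J be a finite index set, and for each j ∈ J fix a point x_j ∈ ℝ^d, a prior p_j ∈ (0,1) and a real weight a_j ∈ ℝ. Define the CNE per-node log-likelihood L : ℝ^d → ℝ by L(x) = Σ_{j ∈ J} [ a_j · log P_{p_j}(x, x_j) + (1 − a_j) · log(1 − P_{p_j}(x, x_j)) ]. Then L is differentiable and its gradient at any x ∈ ℝ^d equals γ · Σ_{j ∈ J} ( P_{p_j}(x, x_j) − a_j ) · (x − x_j). -/

import Mathlib

/-- The half-normal density with spread parameter `σ`. -/
noncomputable def halfNormal (σ r : ℝ) : ℝ :=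
  (Real.sqrt 2 / (σ * Real.sqrt Real.pi)) * Real.exp (-(r ^ 2) / (2 * σ ^ 2))

/-- The CNE link probability of two points `x y : ℝ^d` with prior `p`. -/
noncomputable def cneP (σ₁ σ₂ p : ℝ) {d : ℕ} (x y : EuclideanSpace ℝ (Fin d)) : ℝ :=
  p * halfNormal σ₁ ‖x - y‖ /
    (p * halfNormal σ₁ ‖x - y‖ + (1 - p) * halfNormal σ₂ ‖x - y‖)

theorem halfNormal_pos {σ : ℝ} (hσ : 0 < σ) (r : ℝ) : 0 < halfNormal σ r := by
  unfold halfNormal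
  positivity

/-- The gradient of `x ↦ N_σ(‖x - y‖)`, as a Fréchet derivative. -/
theorem hasFDerivAt_halfNormal_norm_sub {E : Type*} [NormedAddCommGroup E]
    [InnerProductSpace ℝ E] {σ : ℝ} (hσ : 0 < σ) (x y : E) :
    HasFDerivAt (fun z => halfNormal σ ‖z - y‖)
      ((-(halfNormal σ ‖x - y‖ / σ ^ 2)) • innerSL ℝ (x - y)) x := by
  have h := ((hasFDerivAt_id x).sub_const y).norm_sq
  have h' := ((h.fun_neg.mul_const (2 * σ ^ 2)⁻¹).exp).const_mul
    (Real.sqrt 2 / (σ * Real.sqrt Real.pi))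
  simp only [id, ← div_eq_mul_inv] at h'
  refine h'.congr_fderiv ?_
  ext v
  simp only [halfNormal, smul_apply, neg_apply,
    ContinuousLinearMap.comp_apply, ContinuousLinearMap.id_apply, innerSL_apply_apply, smul_eq_mul,
    nsmul_eq_mul, Nat.cast_ofNat]
  field_simp

/-- The Fréchet derivative of a single term of the CNE log-likelihood. -/
theorem hasFDerivAt_cne_term {d : ℕ} {σ₁ σ₂ p : ℝ} (hσ₁ : 0 < σ₁) (hσ₂ : 0 < σ₂)
    (hp0 : 0 < p) (hp1 : p < 1) (a : ℝ) (x y : EuclideanSpace ℝ (Fin d)) :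
    HasFDerivAt (fun z => a * Real.log (cneP σ₁ σ₂ p z y)
        + (1 - a) * Real.log (1 - cneP σ₁ σ₂ p z y))
      (((1 / σ₁ ^ 2 - 1 / σ₂ ^ 2) * (cneP σ₁ σ₂ p x y - a)) • innerSL ℝ (x - y)) x := by
  have hA (z : EuclideanSpace ℝ (Fin d)) : 0 < p * halfNormal σ₁ ‖z - y‖ :=
    mul_pos hp0 (halfNormal_pos hσ₁ _)
  have hB (z : EuclideanSpace ℝ (Fin d)) : 0 < (1 - p) * halfNormal σ₂ ‖z - y‖ :=
    mul_pos (sub_pos.2 hp1) (halfNormal_pos hσ₂ _)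
  have hsplit : (fun z => a * Real.log (cneP σ₁ σ₂ p z y)
        + (1 - a) * Real.log (1 - cneP σ₁ σ₂ p z y)) =
      fun z => a * Real.log (p * halfNormal σ₁ ‖z - y‖)
        + (1 - a) * Real.log ((1 - p) * halfNormal σ₂ ‖z - y‖)
        - Real.log (p * halfNormal σ₁ ‖z - y‖ + (1 - p) * halfNormal σ₂ ‖z - y‖) := by
    funext z
    have hS := add_pos (hA z) (hB z)
    have hq : 1 - cneP σ₁ σ₂ p z y = (1 - p) * halfNormal σ₂ ‖z - y‖ /
        (p * halfNormal σ₁ ‖z - y‖ + (1 - p) * halfNormal σ₂ ‖z - y‖) := by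
      rw [cneP, one_sub_div hS.ne', add_sub_cancel_left]
    rw [hq, cneP, Real.log_div (hA z).ne' hS.ne', Real.log_div (hB z).ne' hS.ne']
    ring
  rw [hsplit]
  have dA := (hasFDerivAt_halfNormal_norm_sub hσ₁ x y).const_mul p
  have dB := (hasFDerivAt_halfNormal_norm_sub hσ₂ x y).const_mul (1 - p)
  have hS := add_pos (hA x) (hB x)
  refine ((((dA.log (hA x).ne').const_mul a).add ((dB.log (hB x).ne').const_mul (1 - a))).sub
    ((dA.add dB).log hS.ne')).congr_fderiv ?_
  have hp : 1 - p ≠ 0 := (sub_pos.2 hp1).ne'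
  have hN₁ := (halfNormal_pos hσ₁ ‖x - y‖).ne'
  have hN₂ := (halfNormal_pos hσ₂ ‖x - y‖).ne'
  have hS' := hS.ne'
  simp only [smul_smul, ← add_smul, ← sub_smul, Pi.add_apply, cneP]
  congr 1
  generalize halfNormal σ₁ ‖x - y‖ = M at *
  generalize halfNormal σ₂ ‖x - y‖ = N at *
  field_simp
  ring

/-- The CNE per-node log-likelihood
`L(x) = Σ_j [a_j·log P_{p_j}(x, x_j) + (1 − a_j)·log(1 − P_{p_j}(x, x_j))]`
is differentiable and its gradient at any `x` equals
`γ · Σ_j (P_{p_j}(x, x_j) − a_j) · (x − x_j)`. -/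
theorem cne_loglikelihood_gradient (d : ℕ) (hd : 1 ≤ d)
    (σ₁ σ₂ : ℝ) (hσ₁ : 0 < σ₁) (hσ₁₂ : σ₁ < σ₂)
    (γ : ℝ) (hγ : γ = 1 / σ₁ ^ 2 - 1 / σ₂ ^ 2)
    (J : Type*) [Fintype J]
    (xs : J → EuclideanSpace ℝ (Fin d)) (p : J → ℝ)
    (hp0 : ∀ j, 0 < p j) (hp1 : ∀ j, p j < 1) (a : J → ℝ)
    (L : EuclideanSpace ℝ (Fin d) → ℝ)
    (hL : L = fun x => ∑ j : J,
      (a j * Real.log (cneP σ₁ σ₂ (p j) x (xs j))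
        + (1 - a j) * Real.log (1 - cneP σ₁ σ₂ (p j) x (xs j)))) :
    Differentiable ℝ L ∧
    ∀ x : EuclideanSpace ℝ (Fin d),
      gradient L x = γ • ∑ j : J, (cneP σ₁ σ₂ (p j) x (xs j) - a j) • (x - xs j) := by
  have key (x : EuclideanSpace ℝ (Fin d)) :
      HasGradientAt L (γ • ∑ j : J, (cneP σ₁ σ₂ (p j) x (xs j) - a j) • (x - xs j)) x := by
    rw [hasGradientAt_iff_hasFDerivAt, hL, hγ]
    refine (HasFDerivAt.fun_sum fun j _ => hasFDerivAt_cne_term hσ₁ (hσ₁.trans hσ₁₂)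
      (hp0 j) (hp1 j) (a j) x (xs j)).congr_fderiv ?_
    ext v
    simp [Finset.mul_sum, mul_assoc]
  exact ⟨fun x => (key x).differentiableAt, fun x => (key x).gradient⟩
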